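/- Let X be a type (state space), U a nonempty finite type (control set), f : ℕ → X → U → X the dynamics, ℓ_t, g_t : X → ℝ margin functions, and T a finite horizon. Define the value function W by the backward recursion W_T(x) = max{g_T(x), ℓ_T(x)} and W_t(x) = max{g_t(x), min{ℓ_t(x), min_{u∈U} W_{t+1}(f_t(x,u))}} for t < T. Then for every s ≤ T and every x ∈ X, W_s(x) equals the minimum over all finite control sequences u_s,…,u_{T−1} ∈ U of J_s(x) = min_{t∈{s,…,T}} max{ℓ_t(x_t), max_{τ∈{s,…,t}} g_τ(x_τ)}, where x_s = x and x_{t+1} = f_t(x_t, u_t); i.e., the reach-avoid Bellman recursion computes the optimal reach-avoid value. -/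

import Mathlib

/-- Reach-avoid objective-to-go: J_s = min_{t∈{s,…,T}} max{a_t, max_{τ∈{s,…,t}} b_τ}. -/
noncomputable def raJ (T : ℕ) (a b : ℕ → ℝ) (s : ℕ) (hs : s ≤ T) : ℝ :=
  (Finset.Icc s T).attach.inf'
    (Finset.attach_nonempty_iff.mpr (Finset.nonempty_Icc.mpr hs))
    fun t => max (a t.1)
      ((Finset.Icc s t.1).sup' (Finset.nonempty_Icc.mpr (Finset.mem_Icc.mp t.2).1) b)

/-- Open-loop trajectory: `x_s = x`, `x_{t+1} = f_t(x_t, u_t)` for `t ≥ s`. -/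
def traj {X U : Type*} (f : ℕ → X → U → X) (u : ℕ → U) (s : ℕ) (x : X) (t : ℕ) : X :=
  Nat.rec (motive := fun _ => X) x (fun k xk => f (s + k) xk (u (s + k))) (t - s)

theorem raJ_le_iff {T : ℕ} {a b : ℕ → ℝ} {s : ℕ} {hs : s ≤ T} {c : ℝ} :
    raJ T a b s hs ≤ c ↔
      ∃ t, s ≤ t ∧ t ≤ T ∧ a t ≤ c ∧ ∀ τ, s ≤ τ → τ ≤ t → b τ ≤ c := by
  simp [raJ, Finset.inf'_le_iff, and_assoc, and_left_comm]

theorem raJ_congr {T : ℕ} {a a' b b' : ℕ → ℝ} {s : ℕ} (hs : s ≤ T)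
    (ha : ∀ t, s ≤ t → a t = a' t) (hb : ∀ t, s ≤ t → b t = b' t) :
    raJ T a b s hs = raJ T a' b' s hs := by
  refine eq_of_forall_ge_iff fun c => ?_
  simp only [raJ_le_iff]
  grind

theorem raJ_self (T : ℕ) (a b : ℕ → ℝ) : raJ T a b T le_rfl = max (b T) (a T) := by
  refine eq_of_forall_ge_iff fun c => ?_
  rw [raJ_le_iff, max_le_iff]
  grind

theorem raJ_of_lt {T s : ℕ} (a b : ℕ → ℝ) (hs : s < T) :
    raJ T a b s hs.le = max (b s) (min (a s) (raJ T a b (s + 1) hs)) := by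
  refine eq_of_forall_ge_iff fun c => ?_
  rw [raJ_le_iff, max_le_iff, min_le_iff, raJ_le_iff]
  constructor
  · rintro ⟨t, hst, htT, ha, hb⟩
    refine ⟨hb s le_rfl hst, ?_⟩
    rcases hst.eq_or_lt with rfl | hlt
    · exact Or.inl ha
    · exact Or.inr ⟨t, hlt, htT, ha, fun τ hτ => hb τ (by omega)⟩
  · rintro ⟨hbs, ha | ⟨t, hst, htT, ha, hb⟩⟩
    · refine ⟨s, le_rfl, hs.le, ha, fun τ h h' => ?_⟩
      rwa [le_antisymm h' h]
    · refine ⟨t, by omega, htT, ha, fun τ h h' => ?_⟩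
      rcases h.eq_or_lt with rfl | hlt
      · exact hbs
      · exact hb τ hlt h'

section Trajectory

variable {X U : Type*} (f : ℕ → X → U → X)

theorem traj_self (u : ℕ → U) (s : ℕ) (x : X) : traj f u s x s = x := by
  simp [traj]

theorem traj_add_succ (u : ℕ → U) (s : ℕ) (x : X) (k : ℕ) :
    traj f u s x (s + (k + 1)) = f (s + k) (traj f u s x (s + k)) (u (s + k)) := by
  simp [traj]

theorem traj_eq_traj_succ {u u' : ℕ → U} {s : ℕ} (x : X)
    (hu : ∀ t, s + 1 ≤ t → u t = u' t) {t : ℕ} (ht : s + 1 ≤ t) :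
    traj f u s x t = traj f u' (s + 1) (f s x (u s)) t := by
  obtain ⟨k, rfl⟩ := Nat.exists_eq_add_of_le ht
  induction k with
  | zero => simp [traj]
  | succ k ih =>
    rw [traj_add_succ, ← ih (by omega), ← hu _ (by omega),
      show s + 1 + (k + 1) = s + ((k + 1) + 1) by omega, traj_add_succ,
      show s + (k + 1) = s + 1 + k by omega]

theorem raJ_traj_of_lt (ℓ g : ℕ → X → ℝ) {T s : ℕ} (hs : s < T) (x : X) {u u' : ℕ → U}
    (hu : ∀ t, s + 1 ≤ t → u t = u' t) :
    raJ T (fun t => ℓ t (traj f u s x t)) (fun t => g t (traj f u s x t)) s hs.le =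
      max (g s x) (min (ℓ s x)
        (raJ T (fun t => ℓ t (traj f u' (s + 1) (f s x (u s)) t))
          (fun t => g t (traj f u' (s + 1) (f s x (u s)) t)) (s + 1) hs)) := by
  rw [raJ_of_lt _ _ hs, traj_self]
  congr 2
  exact raJ_congr hs (fun t ht => by rw [traj_eq_traj_succ f x hu ht])
    (fun t ht => by rw [traj_eq_traj_succ f x hu ht])

end Trajectory

/-- The reach-avoid Bellman recursion
`W_T(x) = max{g_T(x), ℓ_T(x)}`,
`W_t(x) = max{g_t(x), min{ℓ_t(x), min_{u∈U} W_{t+1}(f_t(x,u))}}`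
computes the optimal reach-avoid value: for every `s ≤ T` and state `x`,
`W_s(x)` is the minimum over all control sequences of the reach-avoid
objective `J_s` along the resulting trajectory. -/
theorem reach_avoid_bellman_recursion_computes_optimal_value
    {X U : Type*} [Fintype U] [Nonempty U]
    (f : ℕ → X → U → X) (ℓ g : ℕ → X → ℝ) (T : ℕ)
    (W : ℕ → X → ℝ)
    (hWT : ∀ x, W T x = max (g T x) (ℓ T x))
    (hW : ∀ t, t < T → ∀ x, W t x =
      max (g t x) (min (ℓ t x)
        (Finset.univ.inf' Finset.univ_nonempty (fun u : U => W (t + 1) (f t x u))))) :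
    ∀ s (hs : s ≤ T), ∀ x : X,
      IsLeast
        {r : ℝ | ∃ u : ℕ → U,
          r = raJ T (fun t => ℓ t (traj f u s x t)) (fun t => g t (traj f u s x t)) s hs}
        (W s x) := by
  intro s hs
  induction hs using Nat.decreasingInduction with
  | self =>
    intro x
    simp [raJ_self, traj_self, hWT]
  | of_succ s hs ih =>
    intro x
    rw [hW s hs x]
    constructor
    · obtain ⟨v, -, hv⟩ := Finset.exists_mem_eq_inf' Finset.univ_nonempty
        (fun u : U => W (s + 1) (f s x u))
      obtain ⟨u', hu'⟩ := (ih (f s x v)).1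
      refine ⟨Function.update u' s v, ?_⟩
      rw [raJ_traj_of_lt f ℓ g hs x (u' := u')
        (fun t ht => Function.update_of_ne (by omega) _ _), Function.update_self, hv, hu']
    · rintro _ ⟨u, rfl⟩
      rw [raJ_traj_of_lt f ℓ g hs x (fun _ _ => rfl)]
      refine max_le_max le_rfl (min_le_min le_rfl ?_)
      exact (Finset.inf'_le _ (Finset.mem_univ (u s))).trans ((ih _).2 ⟨u, rfl⟩)
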